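/- arXiv:1411.3359 — 2 statements merged into one kernel-verified Lean document; each statement's English description precedes it below -/
import Mathlib

section
/- For every finite maximal antichain Γ ⊂ Φ*, l₀ · Σ_{ρ∈Γ} t_ρ log t_ρ = u₀ · Σ_{ρ∈Γ} t_ρ log c_ρ. -/
/-- `a_ρ = ∏_h a_{ρ_h}` for a word `ρ` over the alphabet `{1,…,M}`. -/
def aword {M : ℕ} (a : Fin M → ℝ) (ρ : List (Fin M)) : ℝ := (ρ.map a).prod

theorem wald_aux {M : ℕ} (t : Fin M → ℝ) (htsum : ∑ i, t i = 1) (x0 : Fin M) (N : ℕ) :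
    ∀ Γ : Finset (List (Fin M)), (∀ ρ ∈ Γ, ρ.length ≤ N) →
    (∀ ρ ∈ Γ, ∀ ω ∈ Γ, ρ ≠ ω → ¬ ρ <+: ω ∧ ¬ ω <+: ρ) →
    (∀ x : ℕ → Fin M, ∃ ρ ∈ Γ, ρ = List.ofFn fun i : Fin ρ.length => x i) →
    ∑ ρ ∈ Γ, aword t ρ = 1 ∧ ∀ b : Fin M → ℝ,
      ∑ ρ ∈ Γ, aword t ρ * (ρ.map b).sum =
        (∑ ρ ∈ Γ, aword t ρ * (ρ.length : ℝ)) * ∑ i, t i * b i := by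
  have hnil : ∀ Γ : Finset (List (Fin M)), [] ∈ Γ →
      (∀ ρ ∈ Γ, ∀ ω ∈ Γ, ρ ≠ ω → ¬ ρ <+: ω ∧ ¬ ω <+: ρ) →
      ∑ ρ ∈ Γ, aword t ρ = 1 ∧ ∀ b : Fin M → ℝ,
      ∑ ρ ∈ Γ, aword t ρ * (ρ.map b).sum =
        (∑ ρ ∈ Γ, aword t ρ * (ρ.length : ℝ)) * ∑ i, t i * b i := by
    intro Γ h hanti
    have : Γ = {[]} := by
      ext ρ
      simp only [Finset.mem_singleton]
      constructor
      · intro hρ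
        by_contra hne
        exact (hanti ρ hρ [] h hne).2 List.nil_prefix
      · rintro rfl; exact h
    subst this
    simp [aword]
  induction N with
  | zero =>
    intro Γ hlen hanti hmax
    obtain ⟨ρ, hρ, -⟩ := hmax fun _ => x0
    have : ρ = [] := List.eq_nil_of_length_eq_zero (Nat.le_zero.mp (hlen ρ hρ))
    exact hnil Γ (this ▸ hρ) hanti
  | succ N ih =>
    intro Γ hlen hanti hmax
    by_cases h0 : [] ∈ Γ
    · exact hnil Γ h0 hanti
    have hinj : ∀ i : Fin M, Function.Injective (List.cons i) := fun i _ _ h => (List.cons.inj h).2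
    let G : Fin M → Finset (List (Fin M)) := fun i => Γ.preimage (List.cons i) (hinj i).injOn
    have hG : ∀ i ρ, ρ ∈ G i ↔ i :: ρ ∈ Γ := fun i ρ => by simp [G]
    have hsum : ∀ f : List (Fin M) → ℝ, ∑ ρ ∈ Γ, f ρ = ∑ i, ∑ ρ ∈ G i, f (i :: ρ) := by
      intro f
      rw [Finset.sum_sigma']
      symm
      refine Finset.sum_bij (fun p _ => p.1 :: p.2) ?_ ?_ ?_ ?_
      · rintro ⟨i, ρ⟩ h
        simpa [hG] using h
      · rintro ⟨i, ρ⟩ - ⟨j, ω⟩ - h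
        simp only [List.cons.injEq] at h
        obtain ⟨rfl, rfl⟩ := h
        rfl
      · intro ρ hρ
        cases ρ with
        | nil => exact absurd hρ h0
        | cons i ρ => exact ⟨⟨i, ρ⟩, by simpa [hG] using hρ, rfl⟩
      · intros; rfl
    have key := fun i => ih (G i)
      (fun ρ h => by simpa using hlen _ ((hG i ρ).1 h))
      (fun ρ h ω h' hne => by
        simpa [List.cons_prefix_cons] using
          hanti _ ((hG i ρ).1 h) _ ((hG i ω).1 h') (fun e => hne (hinj i e)))
      (fun x => by
        obtain ⟨ρ, hρ, e⟩ := hmax (fun n => Nat.casesOn n i x)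
        cases ρ with
        | nil => exact absurd hρ h0
        | cons j ρ =>
          simp only [List.length_cons, List.ofFn_succ, List.cons.injEq] at e
          obtain ⟨e1, e2⟩ := e
          have e1 : j = i := e1
          subst e1
          exact ⟨ρ, (hG _ _).2 hρ, e2⟩)
    have haw : ∀ i ρ, aword t (i :: ρ) = t i * aword t ρ := fun i ρ => by simp [aword]
    have hL : ∑ ρ ∈ Γ, aword t ρ * (ρ.length : ℝ)
        = ∑ i, t i * ∑ ρ ∈ G i, aword t ρ * (ρ.length : ℝ) + 1 := by
      rw [hsum, ← htsum, ← Finset.sum_add_distrib]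
      refine Finset.sum_congr rfl fun i _ => ?_
      conv_rhs => rw [← mul_one (t i), mul_assoc, one_mul, ← (key i).1]
      rw [Finset.mul_sum, Finset.mul_sum, ← Finset.sum_add_distrib]
      refine Finset.sum_congr rfl fun ρ _ => ?_
      rw [haw, List.length_cons]; push_cast; ring
    constructor
    · rw [hsum, ← htsum]
      refine Finset.sum_congr rfl fun i _ => ?_
      simp only [haw]
      rw [← Finset.mul_sum, (key i).1, mul_one]
    · intro b
      rw [hL, hsum, add_mul, one_mul, Finset.sum_mul, ← Finset.sum_add_distrib]
      refine Finset.sum_congr rfl fun i _ => ?_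
      rw [mul_assoc, ← (key i).2 b]
      have : t i * b i = t i * b i * ∑ ρ ∈ G i, aword t ρ := by rw [(key i).1, mul_one]
      rw [this, Finset.mul_sum, Finset.mul_sum, ← Finset.sum_add_distrib]
      refine Finset.sum_congr rfl fun ρ _ => ?_
      rw [haw, List.map_cons, List.sum_cons]; ring

theorem log_aword {M : ℕ} (a : Fin M → ℝ) (ha : ∀ i, 0 < a i) (ρ : List (Fin M)) :
    0 < aword a ρ ∧ Real.log (aword a ρ) = (ρ.map fun i => Real.log (a i)).sum := by
  induction ρ with
  | nil => simp [aword]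
  | cons i ρ ih =>
    have : aword a (i :: ρ) = a i * aword a ρ := by simp [aword]
    rw [this, Real.log_mul (ha i).ne' ih.1.ne', ih.2]
    exact ⟨mul_pos (ha i) ih.1, by simp⟩

theorem stmt17 (M : ℕ) (hM : 2 ≤ M)
    (t : Fin M → ℝ) (ht : ∀ i, 0 < t i) (htsum : ∑ i, t i = 1)
    (c : Fin M → ℝ) (hc : ∀ i, c i ∈ Set.Ioo (0 : ℝ) 1)
    (Γ : Finset (List (Fin M)))
    (hΓne : ∀ ρ ∈ Γ, ρ ≠ [])
    (hanti : ∀ ρ ∈ Γ, ∀ ω ∈ Γ, ρ ≠ ω → ¬ ρ <+: ω ∧ ¬ ω <+: ρ)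
    (hmax : ∀ x : ℕ → Fin M, ∃ ρ ∈ Γ, ρ = List.ofFn fun i : Fin ρ.length => x i) :
    (∑ i, t i * Real.log (c i)) * ∑ ρ ∈ Γ, aword t ρ * Real.log (aword t ρ) =
      (∑ i, t i * Real.log (t i)) * ∑ ρ ∈ Γ, aword t ρ * Real.log (aword c ρ) := by
  have h := (wald_aux t htsum ⟨0, by omega⟩ (Γ.sup List.length) Γ
    (fun ρ hρ => Finset.le_sup (f := List.length) hρ) hanti hmax).2
  simp only [(log_aword t ht _).2, (log_aword c (fun i => (hc i).1) _).2]
  rw [h, h]; ring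
end

section
/- There exist constants N₁ > 0 and N₂ > 0 such that for every j ≥ 1: p₀ q̲^{−j} ≤ M_j ≤ N₁ q̲^{−j}, and M_j ≤ M_{j+1} ≤ N₂ M_j. -/
/-- `p_σ = ∏_h p_{σ_h}` for a word `σ` over the alphabet `{1,…,N}`
(letter `i ∈ {1,…,N}` carries weight `p i`, where `p` is indexed by `{0,1,…,N}`). -/
def pword {N : ℕ} (p : Fin (N + 1) → ℝ) (σ : List (Fin N)) : ℝ :=
  (σ.map fun i => p i.succ).prod

/-- `q̲ = min{ min_{1≤i≤N} p_i, min_{1≤i≤M} t_i }`. -/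
noncomputable def qmin {N M : ℕ} (p : Fin (N + 1) → ℝ) (t : Fin M → ℝ) : ℝ :=
  min (⨅ i : Fin N, p i.succ) (⨅ i : Fin M, t i)

/-- The finite maximal antichain `Γ_j = {σ ∈ Ω^* : p_{σ⁻} ≥ q̲^j > p_σ}`. -/
def GammaJ {N M : ℕ} (p : Fin (N + 1) → ℝ) (t : Fin M → ℝ) (j : ℕ) : Set (List (Fin N)) :=
  {σ | σ ≠ [] ∧ qmin p t ^ j ≤ pword p σ.dropLast ∧ pword p σ < qmin p t ^ j}

/-- `l_{1j}`, the minimal length of a word in `Γ_j`. -/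
noncomputable def l1 {N M : ℕ} (p : Fin (N + 1) → ℝ) (t : Fin M → ℝ) (j : ℕ) : ℕ :=
  sInf {n : ℕ | ∃ σ ∈ GammaJ p t j, σ.length = n}

/-- `Λ*_{Γ_j}`: words of length `≥ l_{1j}` which are proper prefixes of some element
of `Γ_j`. -/
def LamStar {N M : ℕ} (p : Fin (N + 1) → ℝ) (t : Fin M → ℝ) (j : ℕ) : Set (List (Fin N)) :=
  {τ | l1 p t j ≤ τ.length ∧ ∃ σ ∈ GammaJ p t j, τ <+: σ ∧ τ ≠ σ}

/-- `Ψ_j = (⋃_{h=0}^{l_{1j}-1} Ω_h) ∪ Λ*_{Γ_j}` (including the empty word `θ`). -/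
def PsiJ {N M : ℕ} (p : Fin (N + 1) → ℝ) (t : Fin M → ℝ) (j : ℕ) : Set (List (Fin N)) :=
  {τ | τ.length < l1 p t j} ∪ LamStar p t j

/-- `Γ_j(σ) = {ρ ∈ Φ^* : p_σ t_{ρ⁻} ≥ q̲^j > p_σ t_ρ}`. -/
def GammaJw {N M : ℕ} (p : Fin (N + 1) → ℝ) (t : Fin M → ℝ) (σ : List (Fin N)) (j : ℕ) :
    Set (List (Fin M)) :=
  {ρ | ρ ≠ [] ∧ qmin p t ^ j ≤ pword p σ * aword t ρ.dropLast ∧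
    pword p σ * aword t ρ < qmin p t ^ j}

/-- `M_j = ψ_j + Σ_{σ ∈ Ψ_j} ψ_j(σ)`, where `ψ_j = card Γ_j` and `ψ_j(σ) = card Γ_j(σ)`. -/
noncomputable def bigM {N M : ℕ} (p : Fin (N + 1) → ℝ) (t : Fin M → ℝ) (j : ℕ) : ℕ :=
  (GammaJ p t j).ncard + ∑ᶠ σ ∈ PsiJ p t j, (GammaJw p t σ j).ncard

section helpers
open Finset

def Gs {n : ℕ} (w : Fin n → ℝ) (c x : ℝ) : Set (List (Fin n)) :=
  {ρ | ρ ≠ [] ∧ x ≤ c * aword w ρ.dropLast ∧ c * aword w ρ < x}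

def As {n : ℕ} (w : Fin n → ℝ) (c x : ℝ) : Set (List (Fin n)) :=
  {ρ | x ≤ c * aword w ρ}

lemma aword_append {n : ℕ} (w : Fin n → ℝ) (a b : List (Fin n)) :
    aword w (a ++ b) = aword w a * aword w b := by simp [aword]

lemma aword_single {n : ℕ} (w : Fin n → ℝ) (i : Fin n) : aword w [i] = w i := by simp [aword]

lemma aword_nil {n : ℕ} (w : Fin n → ℝ) : aword w [] = 1 := by simp [aword]

lemma aword_pos {n : ℕ} (w : Fin n → ℝ) (hw : ∀ i, 0 < w i) (ρ : List (Fin n)) :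
    0 < aword w ρ := by
  induction ρ with
  | nil => simp [aword]
  | cons a l ih => simp only [aword, List.map_cons, List.prod_cons] at *; exact mul_pos (hw a) ih

lemma aword_le_pow {n : ℕ} (w : Fin n → ℝ) (hw : ∀ i, 0 < w i) (m : ℝ) (hm0 : 0 ≤ m)
    (hm : ∀ i, w i ≤ m) (ρ : List (Fin n)) : aword w ρ ≤ m ^ ρ.length := by
  induction ρ with
  | nil => simp [aword]
  | cons a l ih =>
    have := aword_pos w hw l
    simp only [aword, List.map_cons, List.prod_cons, List.length_cons, pow_succ'] at *
    exact mul_le_mul (hm a) ih this.le hm0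

lemma aword_le_one {n : ℕ} (w : Fin n → ℝ) (hw : ∀ i, 0 < w i) (h1 : ∀ i, w i < 1)
    (ρ : List (Fin n)) : aword w ρ ≤ 1 := by
  simpa using aword_le_pow w hw 1 (by norm_num) (fun i => (h1 i).le) ρ

lemma aword_prefix {n : ℕ} (w : Fin n → ℝ) (hw : ∀ i, 0 < w i) (h1 : ∀ i, w i < 1)
    {a b : List (Fin n)} (h : a <+: b) : aword w b ≤ aword w a := by
  obtain ⟨c, rfl⟩ := h
  rw [aword_append]
  exact mul_le_of_le_one_right (aword_pos w hw a).le (aword_le_one w hw h1 c)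

lemma exists_bound {n : ℕ} (w : Fin n → ℝ) (h1 : ∀ i, w i < 1) :
    ∃ m : ℝ, 0 < m ∧ m < 1 ∧ ∀ i, w i ≤ m := by
  rcases isEmpty_or_nonempty (Fin n) with h | h
  · exact ⟨1/2, by norm_num, by norm_num, fun i => h.elim i⟩
  · obtain ⟨i, hi⟩ := Finite.exists_max w
    exact ⟨max (w i) (1/2), by positivity, max_lt (h1 i) (by norm_num),
      fun k => (hi k).trans (le_max_left _ _)⟩

lemma exists_len {n : ℕ} (w : Fin n → ℝ) (hw : ∀ i, 0 < w i) (h1 : ∀ i, w i < 1)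
    (c x : ℝ) (hc : 0 < c) (hx : 0 < x) :
    ∃ L : ℕ, ∀ ρ : List (Fin n), L ≤ ρ.length → c * aword w ρ < x := by
  obtain ⟨m, hm0, hm1, hm⟩ := exists_bound w h1
  obtain ⟨L, hL⟩ := exists_pow_lt_of_lt_one (div_pos hx hc) hm1
  refine ⟨L, fun ρ hρ => ?_⟩
  have h2 := aword_le_pow w hw m hm0.le hm ρ
  have h3 : m ^ ρ.length ≤ m ^ L := pow_le_pow_of_le_one hm0.le hm1.le hρ
  have h4 : aword w ρ < x / c := by linarith
  rw [lt_div_iff₀ hc] at h4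
  linarith

lemma As_finite {n : ℕ} (w : Fin n → ℝ) (hw : ∀ i, 0 < w i) (h1 : ∀ i, w i < 1)
    (c x : ℝ) (hc : 0 < c) (hx : 0 < x) : (As w c x).Finite := by
  obtain ⟨L, hL⟩ := exists_len w hw h1 c x hc hx
  refine (List.finite_length_lt (Fin n) L).subset fun ρ hρ => ?_
  by_contra h
  exact absurd (hL ρ (not_lt.1 h)) (not_lt.2 hρ)

lemma Gs_finite {n : ℕ} (w : Fin n → ℝ) (hw : ∀ i, 0 < w i) (h1 : ∀ i, w i < 1)
    (c x : ℝ) (hc : 0 < c) (hx : 0 < x) : (Gs w c x).Finite := by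
  refine (((As_finite w hw h1 c x hc hx).prod (Set.finite_univ (α := Fin n))).image
    (fun q => q.1 ++ [q.2])).subset fun ρ hρ => ?_
  obtain ⟨hne, h2, h3⟩ := hρ
  exact ⟨(ρ.dropLast, ρ.getLast hne), ⟨h2, trivial⟩, List.dropLast_append_getLast hne⟩

lemma key_sum {n : ℕ} (w : Fin n → ℝ) (hw : ∀ i, 0 < w i) (h1 : ∀ i, w i < 1)
    (c x : ℝ) (hc : 0 < c) (hxc : x ≤ c) (A G : Finset (List (Fin n)))
    (hA : ∀ ρ, ρ ∈ A ↔ ρ ∈ As w c x) (hG : ∀ ρ, ρ ∈ G ↔ ρ ∈ Gs w c x)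
    (f : List (Fin n) → ℝ) :
    ∑ ρ ∈ A, ∑ i, f (ρ ++ [i]) = ∑ ρ ∈ G, f ρ + ∑ ρ ∈ A, f ρ - f [] := by
  classical
  have hnil : [] ∈ A := by rw [hA]; simpa [As, aword_nil] using hxc
  rw [← Finset.add_sum_erase A f hnil]
  have hdis : Disjoint G (A.erase []) := by
    rw [Finset.disjoint_left]
    intro ρ h2 h3
    have h4 := ((hG ρ).1 h2).2.2
    have h5 := (hA ρ).1 (Finset.mem_of_mem_erase h3)
    exact absurd h4 (not_lt.2 h5)
  have : ∑ ρ ∈ A, ∑ i, f (ρ ++ [i]) = ∑ ρ ∈ G ∪ A.erase [], f ρ := by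
    rw [← Finset.sum_product']
    refine Finset.sum_bij (fun q _ => q.1 ++ [q.2]) ?_ ?_ ?_ ?_
    · rintro ⟨ρ, i⟩ h
      simp only [Finset.mem_product, Finset.mem_univ, and_true] at h
      rw [hA] at h
      simp only [Finset.mem_union, Finset.mem_erase]
      rw [hA, hG]
      by_cases h2 : x ≤ c * aword w (ρ ++ [i])
      · exact Or.inr ⟨by simp, h2⟩
      · exact Or.inl ⟨by simp, by rw [List.dropLast_concat]; exact h, not_le.1 h2⟩
    · rintro ⟨ρ, i⟩ _ ⟨ρ', i'⟩ _ h
      simpa using h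
    · intro ρ h
      have hne : ρ ≠ [] ∧ x ≤ c * aword w ρ.dropLast := by
        rcases Finset.mem_union.1 h with h | h
        · exact ⟨((hG ρ).1 h).1, ((hG ρ).1 h).2.1⟩
        · obtain ⟨h2, h3⟩ := Finset.mem_erase.1 h
          refine ⟨h2, ((hA ρ).1 h3).trans ?_⟩
          exact mul_le_mul_of_nonneg_left
            (aword_prefix w hw h1 (List.dropLast_prefix ρ)) hc.le
      refine ⟨(ρ.dropLast, ρ.getLast hne.1), ?_, List.dropLast_append_getLast hne.1⟩
      simp only [Finset.mem_product, Finset.mem_univ, and_true]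
      rw [hA]; exact hne.2
    · intros; rfl
  rw [this, Finset.sum_union hdis]
  ring

lemma key_w {n : ℕ} (w : Fin n → ℝ) (hw : ∀ i, 0 < w i) (h1 : ∀ i, w i < 1)
    (c x : ℝ) (hc : 0 < c) (hxc : x ≤ c) (A G : Finset (List (Fin n)))
    (hA : ∀ ρ, ρ ∈ A ↔ ρ ∈ As w c x) (hG : ∀ ρ, ρ ∈ G ↔ ρ ∈ Gs w c x) :
    ∑ ρ ∈ G, aword w ρ + (1 - ∑ i, w i) * ∑ ρ ∈ A, aword w ρ = 1 := by
  have h := key_sum w hw h1 c x hc hxc A G hA hG (aword w)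
  simp only [aword_append, aword_single, aword_nil] at h
  simp only [← Finset.mul_sum, ← Finset.sum_mul] at h
  linarith

lemma Gs_card_mono {n : ℕ} (hn : 1 ≤ n) (w : Fin n → ℝ) (hw : ∀ i, 0 < w i) (h1 : ∀ i, w i < 1)
    (c x y : ℝ) (hc : 0 < c) (hxc : x ≤ c) (hy : 0 < y) (hyx : y ≤ x) :
    (Gs w c x).ncard ≤ (Gs w c y).ncard := by
  have hx := hy.trans_le hyx
  have a1 := As_finite w hw h1 c x hc hx
  have a2 := As_finite w hw h1 c y hc hy
  have g1 := Gs_finite w hw h1 c x hc hx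
  have g2 := Gs_finite w hw h1 c y hc hy
  have e1 := key_sum w hw h1 c x hc hxc a1.toFinset g1.toFinset (by simp) (by simp) (fun _ => 1)
  have e2 := key_sum w hw h1 c y hc (hyx.trans hxc) a2.toFinset g2.toFinset (by simp) (by simp)
    (fun _ => 1)
  have hsub : a1.toFinset ⊆ a2.toFinset := by
    rw [Set.Finite.toFinset_subset_toFinset]
    exact fun ρ h => hyx.trans h
  have hcard : (a1.toFinset.card : ℝ) ≤ a2.toFinset.card := by
    exact_mod_cast Finset.card_le_card hsub
  rw [Set.ncard_eq_toFinset_card _ g1, Set.ncard_eq_toFinset_card _ g2]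
  simp only [Finset.sum_const, Finset.card_univ, Fintype.card_fin, nsmul_eq_mul, mul_one] at e1 e2
  have hn' : (1:ℝ) ≤ n := by exact_mod_cast hn
  have : (g1.toFinset.card : ℝ) ≤ g2.toFinset.card := by
    nlinarith
  exact_mod_cast this

lemma exists_prefix {n : ℕ} (w : Fin n → ℝ) (x : ℝ) (hx : x ≤ 1) (τ : List (Fin n)) :
    aword w τ < x → ∃ σ ∈ Gs w 1 x, σ <+: τ := by
  induction τ using List.reverseRecOn with
  | nil => intro h; rw [aword_nil] at h; linarith
  | append_singleton l a ih =>
    intro h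
    by_cases h2 : aword w l < x
    · obtain ⟨σ, h3, h4⟩ := ih h2
      exact ⟨σ, h3, h4.trans (List.prefix_append _ _)⟩
    · exact ⟨l ++ [a], ⟨by simp, by simpa using h2, by simpa using h⟩, List.prefix_rfl⟩

lemma Gamma_eq {N M : ℕ} (p : Fin (N + 1) → ℝ) (t : Fin M → ℝ) (j : ℕ) :
    GammaJ p t j = Gs (fun i => p i.succ) 1 (qmin p t ^ j) := by
  ext σ; simp [GammaJ, Gs, pword, aword]

lemma Gammaw_eq {N M : ℕ} (p : Fin (N + 1) → ℝ) (t : Fin M → ℝ) (σ : List (Fin N)) (j : ℕ) :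
    GammaJw p t σ j = Gs t (pword p σ) (qmin p t ^ j) := rfl

lemma Psi_eq {N M : ℕ} (hN : 1 ≤ N) (p : Fin (N + 1) → ℝ) (t : Fin M → ℝ) (j : ℕ)
    (hw : ∀ i : Fin N, 0 < p i.succ) (h1 : ∀ i : Fin N, p i.succ < 1)
    (hq : 0 < qmin p t ^ j) (hq1 : qmin p t ^ j ≤ 1) :
    PsiJ p t j = As (fun i => p i.succ) 1 (qmin p t ^ j) := by
  ext τ
  simp only [PsiJ, LamStar, As, Set.mem_union, Set.mem_ofPred_eq, Gamma_eq, one_mul, l1]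
  set x := qmin p t ^ j
  set w : Fin N → ℝ := fun i => p i.succ
  constructor
  · rintro (h | ⟨-, σ, hσ, hp, hne⟩)
    · by_contra h2
      obtain ⟨σ, h3, h4⟩ := exists_prefix w x hq1 τ (not_le.1 h2)
      have : sInf {n : ℕ | ∃ σ ∈ Gs w 1 x, σ.length = n} ≤ σ.length := Nat.sInf_le ⟨σ, h3, rfl⟩
      have := h4.length_le
      omega
    · have h2 := hσ.2.1
      rw [one_mul] at h2
      refine h2.trans (aword_prefix w hw h1 ?_)
      obtain ⟨c, rfl⟩ := hp
      have hc : c ≠ [] := by rintro rfl; simp at hne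
      rw [List.dropLast_append_of_ne_nil hc]
      exact List.prefix_append _ _
  · intro h
    by_cases hl : τ.length < sInf {n : ℕ | ∃ σ ∈ Gs w 1 x, σ.length = n}
    · exact Or.inl hl
    · refine Or.inr ⟨not_lt.1 hl, ?_⟩
      obtain ⟨L, hL⟩ := exists_len w hw h1 1 x one_pos hq
      have h2 := hL (τ ++ List.replicate L ⟨0, hN⟩) (by simp)
      rw [one_mul] at h2
      obtain ⟨σ, hσ, hpre⟩ := exists_prefix w x hq1 _ h2
      have h5 : aword w σ < x := by simpa using hσ.2.2
      refine ⟨σ, hσ, ?_, ?_⟩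
      · rcases List.prefix_or_prefix_of_prefix hpre (List.prefix_append τ _) with h3 | h3
        · have := aword_prefix w hw h1 h3
          linarith
        · exact h3
      · rintro rfl
        linarith

lemma qmin_facts {N M : ℕ} (hN : 1 ≤ N) (hM : 1 ≤ M) (p : Fin (N + 1) → ℝ) (t : Fin M → ℝ)
    (hw : ∀ i : Fin N, 0 < p i.succ) (ht : ∀ i, 0 < t i) :
    0 < qmin p t ∧ (∀ i : Fin N, qmin p t ≤ p i.succ) ∧ ∀ i, qmin p t ≤ t i := by
  have : Nonempty (Fin N) := ⟨⟨0, hN⟩⟩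
  have : Nonempty (Fin M) := ⟨⟨0, hM⟩⟩
  refine ⟨lt_min ?_ ?_, fun i => (min_le_left _ _).trans ?_, fun i => (min_le_right _ _).trans ?_⟩
  · obtain ⟨i, hi⟩ := exists_eq_ciInf_of_finite (f := fun i : Fin N => p i.succ)
    rw [← hi]; exact hw i
  · obtain ⟨i, hi⟩ := exists_eq_ciInf_of_finite (f := t)
    rw [← hi]; exact ht i
  · exact ciInf_le (Set.finite_range _).bddBelow i
  · exact ciInf_le (Set.finite_range _).bddBelow i

lemma Gs_lower {n : ℕ} (w : Fin n → ℝ) (q c x : ℝ) (hc : 0 < c) (hq : 0 < q)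
    (hqw : ∀ i, q ≤ w i) (hx : 0 < x) (ρ : List (Fin n)) (h : ρ ∈ Gs w c x) :
    x * q ≤ c * aword w ρ := by
  obtain ⟨hne, h2, -⟩ := h
  have h3 := List.dropLast_append_getLast hne
  rw [← h3, aword_append, aword_single, ← mul_assoc]
  exact mul_le_mul h2 (hqw _) hq.le (hx.le.trans h2)

end helpers

theorem stmt19 (N M : ℕ) (hN : 2 ≤ N) (hM : 2 ≤ M)
    (p : Fin (N + 1) → ℝ) (hp : ∀ i, 0 < p i) (hpsum : ∑ i, p i = 1)
    (t : Fin M → ℝ) (ht : ∀ i, 0 < t i) (htsum : ∑ i, t i = 1) :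
    ∃ N₁ : ℝ, 0 < N₁ ∧ ∃ N₂ : ℝ, 0 < N₂ ∧ ∀ j : ℕ, 1 ≤ j →
      p 0 * (qmin p t ^ j)⁻¹ ≤ (bigM p t j : ℝ) ∧
      (bigM p t j : ℝ) ≤ N₁ * (qmin p t ^ j)⁻¹ ∧
      bigM p t j ≤ bigM p t (j + 1) ∧
      (bigM p t (j + 1) : ℝ) ≤ N₂ * (bigM p t j : ℝ) := by
  have hw : ∀ i : Fin N, 0 < p i.succ := fun i => hp _
  have hps := hpsum
  rw [Fin.sum_univ_succ] at hps
  have h1 : ∀ i : Fin N, p i.succ < 1 := fun i => by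
    have := Finset.single_le_sum (f := fun i : Fin N => p i.succ) (fun i _ => (hw i).le)
      (Finset.mem_univ i)
    have := hp 0
    linarith
  have h1t : ∀ i : Fin M, t i < 1 := fun i => by
    have : Nontrivial (Fin M) := Fin.nontrivial_iff_two_le.2 hM
    obtain ⟨k, hk⟩ := exists_ne i
    have := Finset.add_le_sum (f := t) (s := Finset.univ) (fun i _ => (ht i).le)
      (Finset.mem_univ i) (Finset.mem_univ k) hk.symm
    have := ht k
    linarith
  obtain ⟨hq, hqp, hqt⟩ := qmin_facts (by omega) (by omega) p t hw ht
  have hq1 : qmin p t < 1 := (hqp ⟨0, by omega⟩).trans_lt (h1 _)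
  have hx : ∀ j : ℕ, 0 < qmin p t ^ j := fun j => pow_pos hq j
  have hx1 : ∀ j : ℕ, qmin p t ^ j ≤ 1 := fun j => pow_le_one₀ hq.le hq1.le
  have fA := fun j => As_finite _ hw h1 1 _ one_pos (hx j)
  have fG := fun j => Gs_finite _ hw h1 1 _ one_pos (hx j)
  have hpw : ∀ σ, 0 < pword p σ := fun σ => aword_pos _ hw σ
  have fT := fun j σ => Gs_finite _ ht h1t (pword p σ) _ (hpw σ) (hx j)
  have hM' : ∀ j, bigM p t j = (fG j).toFinset.card
      + ∑ σ ∈ (fA j).toFinset, (fT j σ).toFinset.card := by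
    intro j
    unfold bigM
    rw [Gamma_eq, Psi_eq (by omega) p t j hw h1 (hx j) (hx1 j), Set.ncard_eq_toFinset_card _ (fG j)]
    congr 1
    rw [finsum_mem_eq_finite_toFinset_sum _ (fA j)]
    refine Finset.sum_congr rfl fun σ _ => ?_
    rw [Gammaw_eq, Set.ncard_eq_toFinset_card _ (fT j σ)]
  have hmemA : ∀ j σ, σ ∈ (fA j).toFinset → qmin p t ^ j ≤ pword p σ := by
    intro j σ h
    have h : qmin p t ^ j ≤ 1 * aword (fun i => p i.succ) σ := ((fA j).mem_toFinset).1 h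
    rwa [one_mul] at h
  -- total mass
  have mass : ∀ j, ∑ σ ∈ (fG j).toFinset, pword p σ + p 0 * ∑ σ ∈ (fA j).toFinset,
      ∑ ρ ∈ (fT j σ).toFinset, pword p σ * aword t ρ = 1 := by
    intro j
    have h := key_w _ hw h1 1 _ one_pos (hx1 j) (fA j).toFinset (fG j).toFinset (by simp) (by simp)
    rw [show 1 - ∑ i : Fin N, p i.succ = p 0 by linarith] at h
    refine Eq.trans ?_ h
    congr 2
    refine Finset.sum_congr rfl fun σ hσ => ?_
    have h2 := key_w _ ht h1t (pword p σ) _ (hpw σ) (hmemA j σ hσ)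
      (As_finite _ ht h1t (pword p σ) _ (hpw σ) (hx j)).toFinset (fT j σ).toFinset
      (by simp) (by simp)
    rw [htsum, sub_self, zero_mul, add_zero] at h2
    rw [← Finset.mul_sum, h2, mul_one]; rfl
  have hp0 := hp 0
  have hp01 : p 0 ≤ 1 := by
    have := Finset.sum_nonneg (s := Finset.univ) (f := fun i : Fin N => p i.succ)
      (fun i _ => (hw i).le)
    linarith
  have lower : ∀ j, 1 ≤ (bigM p t j : ℝ) * qmin p t ^ j := by
    intro j
    rw [← mass j, hM' j]
    push_cast
    rw [add_mul, Finset.sum_mul]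
    refine add_le_add ?_ ?_
    · rw [← nsmul_eq_mul]
      refine Finset.sum_le_card_nsmul _ _ _ fun σ hσ => ?_
      have h : σ ∈ Gs (fun i => p i.succ) 1 (qmin p t ^ j) := by simpa using hσ
      have h := h.2.2.le
      rwa [one_mul] at h
    · refine (mul_le_of_le_one_left ?_ hp01).trans (Finset.sum_le_sum fun σ _ => ?_)
      · exact Finset.sum_nonneg fun σ _ => Finset.sum_nonneg fun ρ _ =>
          (mul_pos (hpw σ) (aword_pos t ht ρ)).le
      · rw [← nsmul_eq_mul]
        refine Finset.sum_le_card_nsmul _ _ _ fun ρ hρ => ?_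
        have h : ρ ∈ Gs t (pword p σ) (qmin p t ^ j) := by simpa using hρ
        exact h.2.2.le
  have upper : ∀ j, p 0 * ((bigM p t j : ℝ) * (qmin p t ^ j * qmin p t)) ≤ 1 := by
    intro j
    rw [← mass j, hM' j]
    push_cast
    rw [add_mul, Finset.sum_mul, mul_add]
    refine add_le_add ?_ (mul_le_mul_of_nonneg_left (Finset.sum_le_sum fun σ _ => ?_) hp0.le)
    · refine (mul_le_of_le_one_left ?_ hp01).trans ?_
      · have := hx j
        positivity
      rw [← nsmul_eq_mul]
      refine Finset.card_nsmul_le_sum _ _ _ fun σ hσ => ?_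
      have h := Gs_lower _ _ 1 _ one_pos hq hqp (hx j) σ (by simpa using hσ)
      rwa [one_mul] at h
    · rw [← nsmul_eq_mul]
      refine Finset.card_nsmul_le_sum _ _ _ fun ρ hρ => ?_
      exact Gs_lower _ _ _ _ (hpw σ) hq hqt (hx j) ρ (by simpa using hρ)
  have mono : ∀ j, bigM p t j ≤ bigM p t (j + 1) := by
    intro j
    have hle : qmin p t ^ (j + 1) ≤ qmin p t ^ j := pow_le_pow_of_le_one hq.le hq1.le (by omega)
    rw [hM', hM']
    refine add_le_add ?_ ?_
    · rw [← Set.ncard_eq_toFinset_card _ (fG j), ← Set.ncard_eq_toFinset_card _ (fG (j+1))]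
      exact Gs_card_mono (by omega) _ hw h1 1 _ _ one_pos (hx1 j) (hx _) hle
    · refine (Finset.sum_le_sum fun σ hσ => ?_).trans
        (Finset.sum_le_sum_of_subset (f := fun σ => (fT (j+1) σ).toFinset.card) ?_)
      · rw [← Set.ncard_eq_toFinset_card _ (fT j σ), ← Set.ncard_eq_toFinset_card _ (fT (j+1) σ)]
        exact Gs_card_mono (by omega) _ ht h1t _ _ _ (hpw σ) (hmemA j σ hσ) (hx _) hle
      · rw [Set.Finite.toFinset_subset_toFinset]
        exact fun ρ h => hle.trans h
  have up2 : ∀ j, (bigM p t j : ℝ) ≤ (p 0 * qmin p t)⁻¹ * (qmin p t ^ j)⁻¹ := by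
    intro j
    have := hx j
    rw [← mul_inv, ← one_div, le_div_iff₀ (by positivity)]
    have := upper j
    linarith
  have low2 : ∀ j, (qmin p t ^ j)⁻¹ ≤ (bigM p t j : ℝ) := by
    intro j
    rw [← one_div, div_le_iff₀ (hx j)]
    exact lower j
  refine ⟨(p 0 * qmin p t)⁻¹, by positivity, (p 0 * qmin p t)⁻¹ * (qmin p t)⁻¹, by positivity,
    fun j _ => ⟨?_, up2 j, mono j, ?_⟩⟩
  · have := hx j
    exact (mul_le_of_le_one_left (by positivity) hp01).trans (low2 j)
  · refine (up2 (j+1)).trans ?_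
    rw [pow_succ', mul_inv (qmin p t), ← mul_assoc]
    exact mul_le_mul_of_nonneg_left (low2 j) (by positivity)
end
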